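/- arXiv:1904.08622 — 5 statements merged into one kernel-verified Lean document; each statement's English description precedes it below -/
import Mathlib

section
/- Let X ⊂ ℝⁿ be a measurable set with Lebesgue measure, ρ : X → ℝ a probability density with ρ > 0 almost everywhere, k ∈ ℕ, and η : X → ℝ^k a bounded measurable map; define F(f) = ∫_X η(x') f(x') dx' ∈ ℝ^k for integrable f. Let ε > 0, let (p_x)_{x∈X} be a family of probability densities on X each with finite ‖·‖_{L²_{1/ρ}}-norm, and let M be a set of probability densities on X with finite ‖·‖_{L²_{1/ρ}}-norm such that for every x ∈ X there exists q ∈ M with ‖p_x − q‖_{L²_{1/ρ}} ≤ ε. Then for every x ∈ X, inf_{v ∈ F(M)} ‖v − F(p_x)‖_∞ ≤ ‖η‖_∞ · ε, where ‖·‖_∞ on ℝ^k is the maximum norm and ‖η‖_∞ = ess sup_{x∈X} max_{j≤k} |η_j(x)|. -/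
open MeasureTheory Filter
open scoped ENNReal RealInnerProductSpace

/-- (Proposition 2.10 of the paper.)  Let `X ⊂ ℝⁿ` be measurable with Lebesgue
measure, `ρ` a probability density on `X` with `ρ > 0` a.e., `η : X → ℝᵏ` a bounded measurable
feature map and `F f = ∫_X η(x') f(x') dx'` the corresponding embedding.  If `M` is a set of
probability densities with finite `L²_{1/ρ}`-norm which is `ε`-dense (in `L²_{1/ρ}`) in the
family `(p_x)_{x ∈ X}` of probability densities, then for every `x ∈ X` the max-norm distance
of `F (p_x)` to `F(M)` is at most `‖η‖_∞ ε`. -/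
theorem stmt_3 (n k : ℕ) (X : Set (EuclideanSpace ℝ (Fin n))) (hX : MeasurableSet X)
    (ρ : EuclideanSpace ℝ (Fin n) → ℝ) (hρm : Measurable ρ)
    (hρnonneg : ∀ x, 0 ≤ ρ x) (hρint : ∫ x in X, ρ x = 1)
    (hρpos : ∀ᵐ x ∂(volume.restrict X), 0 < ρ x)
    (η : EuclideanSpace ℝ (Fin n) → Fin k → ℝ) (hηm : Measurable η)
    (hηbdd : IsBoundedUnder (· ≤ ·) (ae (volume.restrict X)) fun x => ‖η x‖)
    (F : (EuclideanSpace ℝ (Fin n) → ℝ) → Fin k → ℝ)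
    (hF : ∀ f, F f = fun j => ∫ x in X, η x j * f x)
    (ε : ℝ) (hε : 0 < ε)
    (p : EuclideanSpace ℝ (Fin n) → EuclideanSpace ℝ (Fin n) → ℝ)
    (hp : ∀ x, Measurable (p x) ∧ (∀ y, 0 ≤ p x y) ∧ (∫ y in X, p x y) = 1 ∧
      Integrable (fun y => p x y ^ 2 / ρ y) (volume.restrict X))
    (M : Set (EuclideanSpace ℝ (Fin n) → ℝ))
    (hM : ∀ q ∈ M, Measurable q ∧ (∀ y, 0 ≤ q y) ∧ (∫ y in X, q y) = 1 ∧
      Integrable (fun y => q y ^ 2 / ρ y) (volume.restrict X))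
    (happrox : ∀ x ∈ X, ∃ q ∈ M,
      Real.sqrt (∫ y in X, (p x y - q y) ^ 2 / ρ y) ≤ ε) :
    ∀ x ∈ X, sInf ((fun q => ‖F q - F (p x)‖) '' M) ≤
      (essSup (fun x => ‖η x‖) (volume.restrict X)) * ε := by
  intro x hx
  obtain ⟨q, hq, hqε⟩ := happrox x hx
  obtain ⟨hpm, hp0, hp1, hp2⟩ := hp x
  obtain ⟨hqm, hq0, hq1, hq2⟩ := hM q hq
  have hbelow : BddBelow ((fun q => ‖F q - F (p x)‖) '' M) := by
    refine ⟨0, ?_⟩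
    rintro _ ⟨r, _, rfl⟩
    exact norm_nonneg _
  refine (csInf_le hbelow ⟨q, hq, rfl⟩).trans ?_
  have hpi : Integrable (p x) (volume.restrict X) := by
    by_contra h
    rw [integral_undef h] at hp1
    exact zero_ne_one hp1
  have hqi : Integrable q (volume.restrict X) := by
    by_contra h
    rw [integral_undef h] at hq1
    exact zero_ne_one hq1
  have hρi : Integrable ρ (volume.restrict X) := by
    by_contra h
    rw [integral_undef h] at hρint
    exact zero_ne_one hρint
  have hE : ∀ᵐ y ∂(volume.restrict X),
      ‖η y‖ ≤ essSup (fun x => ‖η x‖) (volume.restrict X) := ae_le_essSup hηbdd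
  set E := essSup (fun x => ‖η x‖) (volume.restrict X) with hEdef
  have hne : (ae (volume.restrict X)).NeBot := by
    rw [ae_neBot]
    intro h
    rw [h, integral_zero_measure] at hρint
    exact zero_ne_one hρint
  have hE0 : 0 ≤ E := by
    obtain ⟨y, hy⟩ := hE.exists
    exact (norm_nonneg _).trans hy
  have hdi : Integrable (fun y => |p x y - q y|) (volume.restrict X) := (hpi.sub hqi).abs
  have hS : Integrable (fun y => (p x y - q y) ^ 2 / ρ y) (volume.restrict X) := by
    refine (hp2.add hq2).mono' (((hpm.sub hqm).pow_const 2).div hρm).aestronglyMeasurable ?_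
    refine Eventually.of_forall fun y => ?_
    rw [Real.norm_of_nonneg (div_nonneg (sq_nonneg _) (hρnonneg y)), Pi.add_apply, ← add_div]
    refine div_le_div_of_nonneg_right ?_ (hρnonneg y)
    nlinarith [mul_nonneg (hp0 y) (hq0 y)]
  have hA : ∫ y in X, |p x y - q y| ≤ ε := by
    refine le_trans ?_ hqε
    apply Real.le_sqrt_of_sq_le
    set A := ∫ y in X, |p x y - q y| with hAdef
    have key : ∫ y in X, 2 * A * |p x y - q y| ≤
        ∫ y in X, ((p x y - q y) ^ 2 / ρ y + A ^ 2 * ρ y) := by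
      refine integral_mono_ae (hdi.const_mul _) (hS.add (hρi.const_mul _)) ?_
      filter_upwards [hρpos] with y hy
      have h1 : (p x y - q y) ^ 2 / ρ y + A ^ 2 * ρ y - 2 * A * |p x y - q y|
          = (|p x y - q y| - A * ρ y) ^ 2 / ρ y := by
        rw [← sq_abs (p x y - q y)]
        field_simp
        ring
      have h2 := div_nonneg (sq_nonneg (|p x y - q y| - A * ρ y)) hy.le
      linarith
    rw [integral_const_mul, integral_add hS (hρi.const_mul _), integral_const_mul, hρint,
      ← hAdef] at key
    linarith
  refine le_trans ?_ (mul_le_mul_of_nonneg_left hA hE0)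
  have hI0 : 0 ≤ ∫ y in X, |p x y - q y| := integral_nonneg fun y => abs_nonneg _
  rw [pi_norm_le_iff_of_nonneg (mul_nonneg hE0 hI0)]
  intro j
  have hηj : AEStronglyMeasurable (fun y => η y j) (volume.restrict X) :=
    (measurable_pi_iff.1 hηm j).aestronglyMeasurable
  have hjE : ∀ᵐ y ∂(volume.restrict X), ‖η y j‖ ≤ E := by
    filter_upwards [hE] with y hy
    exact (norm_le_pi_norm _ j).trans hy
  rw [Pi.sub_apply, hF, hF]
  simp only
  rw [← integral_sub (hqi.bdd_mul hηj hjE) (hpi.bdd_mul hηj hjE), ← integral_const_mul]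
  refine norm_integral_le_of_norm_le (hdi.const_mul E) ?_
  filter_upwards [hjE] with y hy
  rw [← mul_sub, norm_mul, Real.norm_eq_abs (q y - p x y), abs_sub_comm]
  exact mul_le_mul_of_nonneg_right hy (abs_nonneg _)
end

section
/- Let (X, ν) be a measure space where ν is the Lebesgue measure on a measurable set X ⊂ ℝⁿ, (φ_i)_{i∈ℕ} an orthonormal basis of L²(ν), and (λ_i)_{i∈ℕ} a nonincreasing sequence of nonnegative real numbers; define the Mercer feature embedding T : L²(ν) → ℓ²(ℕ) by (Tf)_i = √λ_i · ⟨f, φ_i⟩_{L²(ν)}. Let ρ : X → ℝ be measurable with ρ > 0 almost everywhere and √ρ essentially bounded. Then for every ε > 0 and all f, g ∈ L²(ν) with finite ‖·‖_{L²_{1/ρ}}-norms satisfying ‖f − g‖_{L²_{1/ρ}} ≤ ε, it holds that ‖Tf − Tg‖_{ℓ²} ≤ √λ_0 · ‖√ρ‖_∞ · ε. -/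
open MeasureTheory Filter
open scoped ENNReal RealInnerProductSpace

/-- (Corollary 3.11 / expansion bound of the paper.)  With `ν` the Lebesgue
measure on a measurable set `X ⊂ ℝⁿ`, `(φ i)` an orthonormal basis of `L²(ν)`, `(λ i)` a
nonincreasing sequence of nonnegative reals, and `T` the Mercer feature embedding
`(T f) i = √(λ i) ⟪f, φ i⟫`, if `ρ` is measurable, a.e. positive with `√ρ` essentially bounded,
then `‖f − g‖_{L²_{1/ρ}} ≤ ε` implies `‖T f − T g‖_{ℓ²} ≤ √(λ 0) ‖√ρ‖_∞ ε`. -/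
theorem stmt_4 (n : ℕ) (X : Set (EuclideanSpace ℝ (Fin n))) (hX : MeasurableSet X)
    (φ : HilbertBasis ℕ ℝ (Lp ℝ 2 (volume.restrict X)))
    (lam : ℕ → ℝ) (hlam_nonneg : ∀ i, 0 ≤ lam i) (hlam_anti : Antitone lam)
    (T : Lp ℝ 2 (volume.restrict X) → lp (fun _ : ℕ => ℝ) 2)
    (hT : ∀ (f : Lp ℝ 2 (volume.restrict X)) (i : ℕ),
      (T f : ∀ _ : ℕ, ℝ) i = Real.sqrt (lam i) * ⟪f, φ i⟫)
    (ρ : EuclideanSpace ℝ (Fin n) → ℝ) (hρm : Measurable ρ)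
    (hρpos : ∀ᵐ x ∂(volume.restrict X), 0 < ρ x)
    (hρbdd : IsBoundedUnder (· ≤ ·) (ae (volume.restrict X)) fun x => Real.sqrt (ρ x))
    (ε : ℝ) (hε : 0 < ε) (f g : Lp ℝ 2 (volume.restrict X))
    (hfg_int : Integrable
      (fun x => ((f : EuclideanSpace ℝ (Fin n) → ℝ) x - (g : EuclideanSpace ℝ (Fin n) → ℝ) x) ^ 2 / ρ x)
      (volume.restrict X))
    (hfg : Real.sqrt (∫ x in X,
        ((f : EuclideanSpace ℝ (Fin n) → ℝ) x - (g : EuclideanSpace ℝ (Fin n) → ℝ) x) ^ 2 / ρ x) ≤ ε) :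
    ‖T f - T g‖ ≤
      Real.sqrt (lam 0) * (essSup (fun x => Real.sqrt (ρ x)) (volume.restrict X)) * ε := by
  generalize volume.restrict X = ν at *
  set M := essSup (fun x => Real.sqrt (ρ x)) ν with hM
  have hle : ∀ᵐ x ∂ν, Real.sqrt (ρ x) ≤ M := ae_le_essSup hρbdd
  have hM0 : 0 ≤ M := by
    rcases eq_or_ne ν 0 with h0 | h0
    · have : M = 0 := by
        rw [hM, h0]
        simp [essSup, limsup, limsSup]
      exact this.ge
    · have : (ae ν).NeBot := ae_neBot.2 h0
      obtain ⟨x, hx⟩ := hle.exists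
      exact (Real.sqrt_nonneg _).trans hx
  have h1 : ‖T f - T g‖ ≤ Real.sqrt (lam 0) * ‖f - g‖ := by
    have h2 : ‖T f - T g‖ ≤ ‖Real.sqrt (lam 0) • φ.repr (f - g)‖ := by
      apply lp.norm_mono (by norm_num)
      intro i
      have e1 : (T f - T g : lp (fun _ : ℕ => ℝ) 2) i = Real.sqrt (lam i) * ⟪φ i, f - g⟫ := by
        rw [lp.coeFn_sub, Pi.sub_apply, hT, hT, real_inner_comm, real_inner_comm (φ i) g,
          inner_sub_right]
        ring
      rw [e1, lp.coeFn_smul, Pi.smul_apply, φ.repr_apply_apply, smul_eq_mul, norm_mul, norm_mul]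
      gcongr
      rw [Real.norm_of_nonneg (Real.sqrt_nonneg _), Real.norm_of_nonneg (Real.sqrt_nonneg _)]
      exact Real.sqrt_le_sqrt (hlam_anti (Nat.zero_le i))
    rwa [norm_smul, Real.norm_of_nonneg (Real.sqrt_nonneg _), LinearIsometryEquiv.norm_map] at h2
  have h3 : ‖f - g‖ ≤ M * ε := by
    have hI : ∫ x, ((f : EuclideanSpace ℝ (Fin n) → ℝ) x - (g : EuclideanSpace ℝ (Fin n) → ℝ) x) ^ 2 / ρ x ∂ν ≤ ε ^ 2 :=
      (Real.sqrt_le_left hε.le).1 hfg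
    have hn : ‖f - g‖ ^ 2 = ∫ x, ((f : EuclideanSpace ℝ (Fin n) → ℝ) x - (g : EuclideanSpace ℝ (Fin n) → ℝ) x) ^ 2 ∂ν := by
      rw [← real_inner_self_eq_norm_sq, L2.inner_def]
      apply integral_congr_ae
      filter_upwards [Lp.coeFn_sub f g] with x hx
      rw [hx]
      simp [sq]
    have hle2 : ‖f - g‖ ^ 2 ≤ (M * ε) ^ 2 := by
      rw [hn, mul_pow]
      refine le_trans ?_ (mul_le_mul_of_nonneg_left hI (sq_nonneg M))
      rw [← integral_const_mul]
      refine integral_mono_of_nonneg (Eventually.of_forall fun x => sq_nonneg _)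
        (hfg_int.const_mul _) ?_
      filter_upwards [hle, hρpos] with x hx hp
      have hr : ρ x ≤ M ^ 2 := (Real.sqrt_le_left hM0).1 hx
      rw [← mul_div_assoc, le_div_iff₀ hp, mul_comm]
      exact mul_le_mul_of_nonneg_right hr (sq_nonneg _)
    exact (sq_le_sq₀ (norm_nonneg _) (by positivity)).1 hle2
  calc _ ≤ _ := h1
    _ ≤ Real.sqrt (lam 0) * (M * ε) := by gcongr
    _ = _ := by ring
end

section
/- Let (X, ν) be a finite measure space with ν the Lebesgue measure on a bounded measurable set X ⊂ ℝⁿ of positive measure, (φ_i)_{i∈ℕ} an orthonormal basis of L²(ν), and (λ_i)_{i∈ℕ} a nonincreasing sequence of nonnegative reals with λ_i → 0 as i → ∞; define T : L²(ν) → ℓ²(ℕ) by (Tf)_i = √λ_i · ⟨f, φ_i⟩_{L²(ν)}. Let ρ : X → ℝ be measurable with 0 < c ≤ ρ(x) ≤ C < ∞ for almost every x and some constants c, C. Then for every ε > 0 there exist p, q ∈ L²(ν) with p ≠ q (as elements of L²) such that ‖p − q‖_{L²_{1/ρ}} > (1/ε) · ‖Tp − Tq‖_{ℓ²}. -/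
open MeasureTheory Filter
open scoped ENNReal RealInnerProductSpace

/-- (Proposition 3.12 of the paper: unbounded inverse embedding.)  With `ν` the
Lebesgue measure on a bounded measurable set `X ⊂ ℝⁿ` of positive measure, `(φ i)` an
orthonormal basis of `L²(ν)`, `(λ i)` nonincreasing, nonnegative with `λ i → 0`, `T` the Mercer
feature embedding, and `ρ` measurable with `0 < c ≤ ρ ≤ C < ∞` a.e., for every `ε > 0` there
are `p ≠ q` in `L²(ν)` with `‖p − q‖_{L²_{1/ρ}} > (1/ε) ‖T p − T q‖`. -/
theorem stmt_5 (n : ℕ) (X : Set (EuclideanSpace ℝ (Fin n))) (hX : MeasurableSet X)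
    (hXbdd : Bornology.IsBounded X) (hXpos : 0 < volume X)
    (φ : HilbertBasis ℕ ℝ (Lp ℝ 2 (volume.restrict X)))
    (lam : ℕ → ℝ) (hlam_nonneg : ∀ i, 0 ≤ lam i) (hlam_anti : Antitone lam)
    (hlam_to_zero : Tendsto lam atTop (nhds 0))
    (T : Lp ℝ 2 (volume.restrict X) → lp (fun _ : ℕ => ℝ) 2)
    (hT : ∀ (f : Lp ℝ 2 (volume.restrict X)) (i : ℕ),
      (T f : ∀ _ : ℕ, ℝ) i = Real.sqrt (lam i) * ⟪f, φ i⟫)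
    (ρ : EuclideanSpace ℝ (Fin n) → ℝ) (hρm : Measurable ρ)
    (c C : ℝ) (hc : 0 < c)
    (hρbound : ∀ᵐ x ∂(volume.restrict X), c ≤ ρ x ∧ ρ x ≤ C)
    (ε : ℝ) (hε : 0 < ε) :
    ∃ p q : Lp ℝ 2 (volume.restrict X), p ≠ q ∧
      Real.sqrt (∫ x in X,
          ((p : EuclideanSpace ℝ (Fin n) → ℝ) x - (q : EuclideanSpace ℝ (Fin n) → ℝ) x) ^ 2 / ρ x) >
        (1 / ε) * ‖T p - T q‖ := by
  have hne : (volume.restrict X) ≠ 0 := by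
    intro h
    rw [Measure.restrict_eq_zero] at h
    exact hXpos.ne' h
  have : NeZero (volume.restrict X) := ⟨hne⟩
  have hC : 0 < C := by
    obtain ⟨x, hx⟩ := hρbound.exists
    linarith [hx.1, hx.2]
  obtain ⟨i, hi⟩ := (hlam_to_zero.eventually_lt_const
    (show (0:ℝ) < ε ^ 2 / C by positivity)).exists
  have hnorm : ‖φ i‖ = 1 := φ.orthonormal.1 i
  refine ⟨φ i, 0, ?_, ?_⟩
  · intro h
    rw [h] at hnorm
    simp at hnorm
  have hTn : ‖T (φ i) - T 0‖ = Real.sqrt (lam i) := by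
    have h : T (φ i) - T 0 = lp.single 2 i (Real.sqrt (lam i)) := by
      ext j
      rw [lp.coeFn_sub, Pi.sub_apply, hT, hT, inner_zero_left, mul_zero, sub_zero]
      by_cases hj : j = i
      · subst hj
        rw [real_inner_self_eq_norm_sq, hnorm]
        simp
      · rw [φ.orthonormal.2 (Ne.symm hj)]
        simp [hj]
    rw [h, lp.norm_single (by norm_num), Real.norm_of_nonneg (Real.sqrt_nonneg _)]
  have hint : Integrable (fun x => (φ i : EuclideanSpace ℝ (Fin n) → ℝ) x ^ 2)
      (volume.restrict X) := (Lp.memLp (φ i)).integrable_sq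
  have hone : ∫ x in X, (φ i : EuclideanSpace ℝ (Fin n) → ℝ) x ^ 2 = 1 := by
    have h : ⟪φ i, φ i⟫ = (1:ℝ) := by rw [real_inner_self_eq_norm_sq, hnorm]; norm_num
    rw [L2.inner_def] at h
    rw [← h]
    congr 1
    ext x
    simp [sq]
  have hae : (fun x => ((φ i : EuclideanSpace ℝ (Fin n) → ℝ) x -
      ((0 : Lp ℝ 2 (volume.restrict X)) : EuclideanSpace ℝ (Fin n) → ℝ) x) ^ 2 / ρ x)
      =ᵐ[volume.restrict X] fun x => (φ i : EuclideanSpace ℝ (Fin n) → ℝ) x ^ 2 / ρ x := by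
    filter_upwards [Lp.coeFn_zero ℝ 2 (volume.restrict X)] with x hx
    rw [hx]
    simp
  have hint2 : Integrable (fun x => (φ i : EuclideanSpace ℝ (Fin n) → ℝ) x ^ 2 / ρ x)
      (volume.restrict X) := by
    refine (hint.div_const c).mono'
      (hint.aestronglyMeasurable.div₀ hρm.aestronglyMeasurable) ?_
    filter_upwards [hρbound] with x hx
    have : 0 < ρ x := hc.trans_le hx.1
    rw [Real.norm_of_nonneg (by positivity)]
    exact div_le_div_of_nonneg_left (sq_nonneg _) hc hx.1
  have hle : 1 / C ≤ ∫ x in X, (φ i : EuclideanSpace ℝ (Fin n) → ℝ) x ^ 2 / ρ x := by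
    rw [← hone, ← integral_div]
    refine integral_mono_ae (hint.div_const C) hint2 ?_
    filter_upwards [hρbound] with x hx
    exact div_le_div_of_nonneg_left (sq_nonneg _) (hc.trans_le hx.1) hx.2
  rw [integral_congr_ae hae, hTn, gt_iff_lt]
  apply Real.lt_sqrt_of_sq_lt
  rw [mul_pow, Real.sq_sqrt (hlam_nonneg i)]
  refine lt_of_lt_of_le ?_ hle
  calc (1 / ε) ^ 2 * lam i < (1 / ε) ^ 2 * (ε ^ 2 / C) := by gcongr
    _ = 1 / C := by field_simp
end

section
/- Let X ⊂ ℝⁿ be a measurable set with Lebesgue measure, d ∈ ℕ with d ≥ 1, q_1, …, q_d : X → ℝ nonnegative measurable functions, and b_1, …, b_d > 0. Let ρ : X → ℝ be measurable with ρ(y) > Σ_{i=1}^d b_i q_i(y) for almost every y and ρ > 0 almost everywhere. Let 0 ≤ δ* < 1, let δ : X → ℝ be measurable with 0 ≤ δ(y) ≤ δ* for all y, let c_1, …, c_d ≥ 0 with Σ_{i=1}^d c_i ≤ 1, and let p : X → ℝ be a probability density (p ≥ 0, ∫_X p = 1) satisfying p(y) = (1/(1 − δ(y))) · Σ_{i=1}^d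 c_i q_i(y) for almost every y. Then ∫_X p(y)²/ρ(y) dy < 1/((1 − δ*) · min_{i} b_i); in particular ‖p‖_{L²_{1/ρ}}² < (1/((1 − δ*) min_i b_i)) · ‖p‖_{L¹} = 1/((1 − δ*) min_i b_i). -/
open MeasureTheory Filter
open scoped ENNReal RealInnerProductSpace

/-- (Lemma 3.14 of the paper.)  Under the metastable decomposition assumption
`p(y) = (1/(1 − δ(y))) ∑ i, c i * q i y` with `0 ≤ δ ≤ δ* < 1`, `c i ≥ 0`, `∑ c i ≤ 1`,
and the invariant-density lower bound `ρ(y) > ∑ i, b i * q i y` a.e. with `b i > 0`, the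
probability density `p` satisfies `‖p‖²_{L²_{1/ρ}} = ∫_X p²/ρ < 1/((1 − δ*) minᵢ b i)`
(in particular the weighted norm is finite). -/
theorem stmt_7 (n d : ℕ) (hd : 1 ≤ d)
    (X : Set (EuclideanSpace ℝ (Fin n))) (hX : MeasurableSet X)
    (q : Fin d → EuclideanSpace ℝ (Fin n) → ℝ)
    (hqm : ∀ i, Measurable (q i)) (hq_nonneg : ∀ i y, 0 ≤ q i y)
    (b : Fin d → ℝ) (hb : ∀ i, 0 < b i)
    (ρ : EuclideanSpace ℝ (Fin n) → ℝ) (hρm : Measurable ρ)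
    (hρlow : ∀ᵐ y ∂(volume.restrict X), (∑ i, b i * q i y) < ρ y)
    (hρpos : ∀ᵐ y ∂(volume.restrict X), 0 < ρ y)
    (δstar : ℝ) (hδstar_nonneg : 0 ≤ δstar) (hδstar_lt : δstar < 1)
    (δ : EuclideanSpace ℝ (Fin n) → ℝ) (hδm : Measurable δ)
    (hδ : ∀ y, 0 ≤ δ y ∧ δ y ≤ δstar)
    (c : Fin d → ℝ) (hc_nonneg : ∀ i, 0 ≤ c i) (hc_sum : ∑ i, c i ≤ 1)
    (p : EuclideanSpace ℝ (Fin n) → ℝ) (hpm : Measurable p)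
    (hp_nonneg : ∀ y, 0 ≤ p y) (hp_int : ∫ y in X, p y = 1)
    (hp_decomp : ∀ᵐ y ∂(volume.restrict X),
      p y = (1 / (1 - δ y)) * ∑ i, c i * q i y) :
    ∫⁻ y in X, ENNReal.ofReal (p y ^ 2 / ρ y) <
      ENNReal.ofReal (1 / ((1 - δstar) * ⨅ i, b i)) := by
  haveI : Nonempty (Fin d) := ⟨⟨0, hd⟩⟩
  obtain ⟨i0, hi0⟩ := exists_eq_ciInf_of_finite (f := b)
  have hm : 0 < ⨅ i, b i := hi0 ▸ hb i0
  have hmle : ∀ i, (⨅ i, b i) ≤ b i := fun i => ciInf_le (Set.finite_range b).bddBelow i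
  generalize (⨅ i, b i) = m at hm hmle
  have h1 : 0 < 1 - δstar := by linarith
  have hK : 0 < 1 / ((1 - δstar) * m) := by positivity
  have hc1 : ∀ i, c i ≤ 1 := fun i =>
    (Finset.single_le_sum (fun j _ => hc_nonneg j) (Finset.mem_univ i)).trans hc_sum
  have hpi : Integrable p (volume.restrict X) := by
    by_contra h
    rw [integral_undef h] at hp_int
    exact zero_ne_one hp_int
  have hlt : ∀ᵐ y ∂(volume.restrict X), p y < 1 / ((1 - δstar) * m) * ρ y := by
    filter_upwards [hρlow, hp_decomp] with y hy hp
    have hS : m * ∑ i, c i * q i y ≤ ∑ i, b i * q i y := by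
      rw [Finset.mul_sum]
      refine Finset.sum_le_sum fun i _ => ?_
      have h2 : c i * q i y ≤ q i y := mul_le_of_le_one_left (hq_nonneg i y) (hc1 i)
      exact (mul_le_mul_of_nonneg_left h2 hm.le).trans
        (mul_le_mul_of_nonneg_right (hmle i) (hq_nonneg i y))
    have hS0 : 0 ≤ ∑ i, c i * q i y :=
      Finset.sum_nonneg fun i _ => mul_nonneg (hc_nonneg i) (hq_nonneg i y)
    have h3 : 0 < 1 - δ y := by linarith [(hδ y).2]
    have h4 : p y * (1 - δ y) = ∑ i, c i * q i y := by
      rw [hp]; field_simp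
    have h5 : p y * (1 - δstar) ≤ p y * (1 - δ y) :=
      mul_le_mul_of_nonneg_left (by linarith [(hδ y).2]) (hp_nonneg y)
    rw [one_div_mul_eq_div, lt_div_iff₀ (by positivity)]
    have h6 : m * (p y * (1 - δstar)) ≤ m * ∑ i, c i * q i y :=
      mul_le_mul_of_nonneg_left (h4 ▸ h5) hm.le
    calc p y * ((1 - δstar) * m) = m * (p y * (1 - δstar)) := by ring
      _ < ρ y := by linarith
  have hint : ∫⁻ y in X, ENNReal.ofReal (1 / ((1 - δstar) * m) * p y)
      = ENNReal.ofReal (1 / ((1 - δstar) * m)) := by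
    rw [← ofReal_integral_eq_lintegral_ofReal (hpi.const_mul _)
      (ae_of_all _ fun y => mul_nonneg hK.le (hp_nonneg y)), integral_const_mul, hp_int, mul_one]
  rw [← hint]
  have hle : ∀ᵐ y ∂(volume.restrict X), p y ^ 2 / ρ y ≤ 1 / ((1 - δstar) * m) * p y := by
    filter_upwards [hlt, hρpos] with y h hr
    rw [div_le_iff₀ hr]
    nlinarith [mul_le_mul_of_nonneg_left h.le (hp_nonneg y)]
  have hle' : (fun y => ENNReal.ofReal (p y ^ 2 / ρ y)) ≤ᵐ[volume.restrict X]
      fun y => ENNReal.ofReal (1 / ((1 - δstar) * m) * p y) :=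
    hle.mono fun y h => ENNReal.ofReal_le_ofReal h
  have hs : (volume.restrict X) {y | 0 < p y} ≠ 0 := by
    intro h0
    have hz : p =ᵐ[volume.restrict X] 0 := by
      refine measure_mono_null (fun y hy => ?_) h0
      exact lt_of_le_of_ne (hp_nonneg y) (fun h => hy h.symm)
    rw [integral_congr_ae hz] at hp_int
    simp at hp_int
  refine lintegral_strict_mono_of_ae_le_of_ae_lt_on (s := {y | 0 < p y})
    (by fun_prop) ?_ hle' hs ?_
  · refine ((lintegral_mono_ae hle').trans_lt ?_).ne
    rw [hint]
    exact ENNReal.ofReal_lt_top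
  · filter_upwards [hlt, hρpos] with y h hr hy
    have hy : 0 < p y := hy
    rw [ENNReal.ofReal_lt_ofReal_iff (by positivity), div_lt_iff₀ hr]
    nlinarith [mul_lt_mul_of_pos_left h hy]
end

section
/- Let X ⊂ ℝⁿ be a bounded measurable set with finite Lebesgue measure |X| > 0, d ∈ ℕ with d ≥ 1, q_1, …, q_d : X → ℝ nonnegative measurable functions, and b_1, …, b_d > 0. Let ρ : X → ℝ be measurable with ρ(y) > Σ_{i=1}^d b_i q_i(y) for almost every y and ρ > 0 almost everywhere. Let 0 ≤ δ* < 1, and for j = 1, 2 let δ_j : X → ℝ be measurable with 0 ≤ δ_j(y) ≤ δ* for all y, let c_1^j, …, c_d^j ∈ [0, 1] with Σ_{i=1}^d c_i^j ≤ 1, and let p^j : X → ℝ be a probability density satisfying p^j(y) = (1/(1 − δ_j(y))) · Σ_{i=1}^d c_i^j q_i(y) for almost every y. Assume p¹ ≠ p² on a set of positive Lebesgue measure. Then ‖p¹ − p²‖_{L²_{1/ρ}}² < (|X|^{1/2}/((1 − δ*) · min_i b_i)) · ‖p¹ − p²‖_{L²}. -/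
open MeasureTheory Filter
open scoped ENNReal RealInnerProductSpace

/-- (Lemma 3.15 of the paper.)  Under the metastable decomposition assumption
for two probability densities `p¹, p²` (with coefficients `c i ∈ [0,1]`, `∑ c i ≤ 1`,
`0 ≤ δ_j ≤ δ* < 1`) on a bounded measurable `X ⊂ ℝⁿ` of positive finite Lebesgue measure, and
the lower bound `ρ(y) > ∑ i, b i * q i y` a.e. with `b i > 0`, if `p¹ ≠ p²` on a set of
positive measure then `‖p¹ − p²‖²_{L²_{1/ρ}} < (|X|^{1/2}/((1 − δ*) minᵢ b i)) ‖p¹ − p²‖_{L²}`. -/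
theorem stmt_8 (n d : ℕ) (hd : 1 ≤ d)
    (X : Set (EuclideanSpace ℝ (Fin n))) (hX : MeasurableSet X)
    (hXbdd : Bornology.IsBounded X) (hXpos : 0 < volume X) (hXfin : volume X < ⊤)
    (q : Fin d → EuclideanSpace ℝ (Fin n) → ℝ)
    (hqm : ∀ i, Measurable (q i)) (hq_nonneg : ∀ i y, 0 ≤ q i y)
    (b : Fin d → ℝ) (hb : ∀ i, 0 < b i)
    (ρ : EuclideanSpace ℝ (Fin n) → ℝ) (hρm : Measurable ρ)
    (hρlow : ∀ᵐ y ∂(volume.restrict X), (∑ i, b i * q i y) < ρ y)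
    (hρpos : ∀ᵐ y ∂(volume.restrict X), 0 < ρ y)
    (δstar : ℝ) (hδstar_nonneg : 0 ≤ δstar) (hδstar_lt : δstar < 1)
    (δ₁ δ₂ : EuclideanSpace ℝ (Fin n) → ℝ) (hδ₁m : Measurable δ₁) (hδ₂m : Measurable δ₂)
    (hδ₁ : ∀ y, 0 ≤ δ₁ y ∧ δ₁ y ≤ δstar) (hδ₂ : ∀ y, 0 ≤ δ₂ y ∧ δ₂ y ≤ δstar)
    (c₁ c₂ : Fin d → ℝ)
    (hc₁ : ∀ i, c₁ i ∈ Set.Icc (0 : ℝ) 1) (hc₂ : ∀ i, c₂ i ∈ Set.Icc (0 : ℝ) 1)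
    (hc₁sum : ∑ i, c₁ i ≤ 1) (hc₂sum : ∑ i, c₂ i ≤ 1)
    (p₁ p₂ : EuclideanSpace ℝ (Fin n) → ℝ) (hp₁m : Measurable p₁) (hp₂m : Measurable p₂)
    (hp₁_nonneg : ∀ y, 0 ≤ p₁ y) (hp₂_nonneg : ∀ y, 0 ≤ p₂ y)
    (hp₁_int : ∫ y in X, p₁ y = 1) (hp₂_int : ∫ y in X, p₂ y = 1)
    (hp₁_decomp : ∀ᵐ y ∂(volume.restrict X),
      p₁ y = (1 / (1 - δ₁ y)) * ∑ i, c₁ i * q i y)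
    (hp₂_decomp : ∀ᵐ y ∂(volume.restrict X),
      p₂ y = (1 / (1 - δ₂ y)) * ∑ i, c₂ i * q i y)
    (hneq : ¬ (p₁ =ᵐ[volume.restrict X] p₂)) :
    ∫⁻ y in X, ENNReal.ofReal ((p₁ y - p₂ y) ^ 2 / ρ y) <
      ENNReal.ofReal (Real.sqrt (volume X).toReal / ((1 - δstar) * ⨅ i, b i)) *
        (∫⁻ y in X, ENNReal.ofReal ((p₁ y - p₂ y) ^ 2)) ^ (1 / 2 : ℝ) := by
  have : Nonempty (Fin d) := ⟨⟨0, hd⟩⟩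
  obtain ⟨i0, hi0⟩ := exists_eq_ciInf_of_finite (f := b)
  have hble : ∀ i, (⨅ i, b i) ≤ b i := fun i => ciInf_le (Set.finite_range b).bddBelow i
  have hmpos : 0 < ⨅ i, b i := hi0 ▸ hb i0
  set m := ⨅ i, b i with hm
  have hδ : 0 < 1 - δstar := by linarith
  set K := 1 / ((1 - δstar) * m) with hK
  have hKpos : 0 < K := by positivity
  have hi₁ : Integrable p₁ (volume.restrict X) := by
    by_contra h
    rw [integral_undef h] at hp₁_int
    norm_num at hp₁_int
  have hi₂ : Integrable p₂ (volume.restrict X) := by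
    by_contra h
    rw [integral_undef h] at hp₂_int
    norm_num at hp₂_int
  -- pointwise bound on each density
  have key : ∀ (c : Fin d → ℝ) (t y), (∀ i, c i ∈ Set.Icc (0 : ℝ) 1) → t ≤ δstar →
      (1 / (1 - t)) * ∑ i, c i * q i y ≤ K * ∑ i, b i * q i y := by
    intro c t y hc ht
    have h1 : ∑ i, c i * q i y ≤ (1 / m) * ∑ i, b i * q i y := by
      rw [Finset.mul_sum]
      refine Finset.sum_le_sum fun i _ => ?_
      rw [← mul_assoc]
      refine mul_le_mul_of_nonneg_right ?_ (hq_nonneg i y)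
      refine (hc i).2.trans ?_
      rw [one_div, inv_mul_eq_div, le_div_iff₀ hmpos]
      linarith [hble i]
    have h0 : 0 ≤ ∑ i, c i * q i y :=
      Finset.sum_nonneg fun i _ => mul_nonneg (hc i).1 (hq_nonneg i y)
    calc (1 / (1 - t)) * ∑ i, c i * q i y ≤ (1 / (1 - δstar)) * ∑ i, c i * q i y := by
          refine mul_le_mul_of_nonneg_right ?_ h0
          exact one_div_le_one_div_of_le hδ (by linarith)
      _ ≤ (1 / (1 - δstar)) * ((1 / m) * ∑ i, b i * q i y) :=
          mul_le_mul_of_nonneg_left h1 (by positivity)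
      _ = K * ∑ i, b i * q i y := by rw [hK]; field_simp
  have habs : ∀ᵐ y ∂(volume.restrict X), 0 < ρ y ∧ |p₁ y - p₂ y| < K * ρ y := by
    filter_upwards [hρlow, hρpos, hp₁_decomp, hp₂_decomp] with y h1 h2 h3 h4
    refine ⟨h2, ?_⟩
    have h5 := key c₁ (δ₁ y) y hc₁ (hδ₁ y).2
    have h6 := key c₂ (δ₂ y) y hc₂ (hδ₂ y).2
    rw [← h3] at h5
    rw [← h4] at h6
    have h7 := mul_lt_mul_of_pos_left h1 hKpos
    rw [abs_lt]
    constructor <;> linarith [hp₁_nonneg y, hp₂_nonneg y]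
  have hle : ∀ᵐ y ∂(volume.restrict X),
      ENNReal.ofReal ((p₁ y - p₂ y) ^ 2 / ρ y) ≤ ENNReal.ofReal (K * |p₁ y - p₂ y|) := by
    filter_upwards [habs] with y hy
    refine ENNReal.ofReal_le_ofReal ?_
    rw [div_le_iff₀ hy.1, ← sq_abs]
    nlinarith [abs_nonneg (p₁ y - p₂ y), hy.2]
  have hlt : ∃ᵐ y ∂(volume.restrict X),
      ENNReal.ofReal ((p₁ y - p₂ y) ^ 2 / ρ y) ≠ ENNReal.ofReal (K * |p₁ y - p₂ y|) := by
    intro hcon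
    apply hneq
    filter_upwards [habs, hcon] with y hy hc
    by_contra hne
    apply hc
    have hp : 0 < |p₁ y - p₂ y| := abs_pos.2 (sub_ne_zero.2 hne)
    refine ne_of_lt ((ENNReal.ofReal_lt_ofReal_iff (by positivity)).2 ?_)
    rw [div_lt_iff₀ hy.1, ← sq_abs]
    nlinarith [hy.2]
  have hgm : Measurable fun y => ENNReal.ofReal (K * |p₁ y - p₂ y|) := by fun_prop
  have hgfin : ∫⁻ y in X, ENNReal.ofReal (K * |p₁ y - p₂ y|) ≠ ⊤ := by
    have h := ((hi₁.sub hi₂).abs.const_mul K).lintegral_lt_top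
    exact h.ne
  have hstrict : ∫⁻ y in X, ENNReal.ofReal ((p₁ y - p₂ y) ^ 2 / ρ y) <
      ∫⁻ y in X, ENNReal.ofReal (K * |p₁ y - p₂ y|) :=
    lintegral_strict_mono_of_ae_le_of_frequently_ae_lt hgm.aemeasurable
      ((lintegral_mono_ae hle).trans_lt hgfin.lt_top).ne hle hlt
  refine hstrict.trans_le ?_
  have hhol := ENNReal.lintegral_mul_le_Lp_mul_Lq (volume.restrict X)
    (Real.HolderConjugate.two_two)
    (f := fun y => ENNReal.ofReal |p₁ y - p₂ y|) (g := fun _ => 1)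
    (by fun_prop) (by fun_prop)
  have e1 : ∀ y, ENNReal.ofReal |p₁ y - p₂ y| ^ (2 : ℝ) = ENNReal.ofReal ((p₁ y - p₂ y) ^ 2) := by
    intro y
    rw [ENNReal.rpow_two, ← ENNReal.ofReal_pow (abs_nonneg _), sq_abs]
  simp only [Pi.mul_apply, mul_one, e1, ENNReal.one_rpow, lintegral_const, one_mul,
    Measure.restrict_apply_univ] at hhol
  have e2 : ENNReal.ofReal (Real.sqrt (volume X).toReal / ((1 - δstar) * m)) =
      ENNReal.ofReal K * volume X ^ (1 / 2 : ℝ) := by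
    rw [div_eq_mul_one_div, ← hK, mul_comm, ENNReal.ofReal_mul hKpos.le, Real.sqrt_eq_rpow,
      ← ENNReal.ofReal_rpow_of_nonneg ENNReal.toReal_nonneg (by norm_num),
      ENNReal.ofReal_toReal hXfin.ne]
  simp only [ENNReal.ofReal_mul hKpos.le]
  rw [lintegral_const_mul _ (by fun_prop), e2, mul_assoc]
  refine mul_le_mul_right ?_ _
  rw [mul_comm (volume X ^ _)]
  exact hhol
end
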